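/- Fix an integer n ≥ 2. Suppose that for every ε > 0 and every H > 0 there exists N₀ such that for every integer N ≥ N₀ and every nonzero polynomial Q in n real variables of total degree at most N, there exists a unit vector v ∈ S^{n-1} that is NOT (N, ε, H)-singular with respect to Q. Then every Kakeya set K ⊆ ℝ^n satisfies: for every κ > 0 there exists c > 0 such that for all δ with 0 < δ < 1, the Lebesgue measure of the δ-neighborhood of K is at least c·δ^κ (i.e., K has lower Minkowski dimension n). -/

import Mathlib

open MeasureTheory ENNReal

/-- The closed grid cube of side `δ` indexed by `k ∈ ℤ^n`. -/
def gridCube (n : ℕ) (δ : ℝ) (k : Fin n → ℤ) : Set (EuclideanSpace ℝ (Fin n)) :=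
  {x | ∀ i, x i ∈ Set.Icc ((k i : ℝ) * δ) (((k i : ℝ) + 1) * δ)}

/-- The unit cube `[0,1]^n`. -/
def unitCube (n : ℕ) : Set (EuclideanSpace ℝ (Fin n)) :=
  {x | ∀ i, x i ∈ Set.Icc (0 : ℝ) 1}

/-- A set `Δ` is roughly bisected by the polynomial `Q` if both `{Q > 0}` and `{Q < 0}`
occupy at least a tenth of the volume of `Δ`. -/
def RoughlyBisected {n : ℕ} (Q : MvPolynomial (Fin n) ℝ)
    (Δ : Set (EuclideanSpace ℝ (Fin n))) : Prop :=
  (10 : ℝ≥0∞)⁻¹ * volume Δ ≤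
      volume {x ∈ Δ | 0 < MvPolynomial.eval (fun i => x i) Q} ∧
  (10 : ℝ≥0∞)⁻¹ * volume Δ ≤
      volume {x ∈ Δ | MvPolynomial.eval (fun i => x i) Q < 0}

/-- A unit vector `v` is `(N, ε, H)`-singular with respect to `Q` if there is a line
with direction `v` such that at least `H⁻¹ · N^{1+ε}` of the `N^{-(1+ε)}`-grid cubes
contained in `[0,1]^n` are roughly bisected by `Q` and intersect the line. -/
def IsSingularDir {n : ℕ} (N : ℕ) (ε H : ℝ) (Q : MvPolynomial (Fin n) ℝ)
    (v : EuclideanSpace ℝ (Fin n)) : Prop :=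
  ∃ x : EuclideanSpace ℝ (Fin n),
    H⁻¹ * (N : ℝ) ^ ((1 : ℝ) + ε) ≤
      (Set.ncard {k : Fin n → ℤ |
          gridCube n ((N : ℝ) ^ (-(1 + ε))) k ⊆ unitCube n ∧
          RoughlyBisected Q (gridCube n ((N : ℝ) ^ (-(1 + ε))) k) ∧
          (gridCube n ((N : ℝ) ^ (-(1 + ε))) k ∩
            {y | ∃ t : ℝ, y = x + t • v}).Nonempty} : ℝ)

/-- A Kakeya set in `ℝ^n`: a compact set containing a unit segment in every direction. -/
def IsKakeyaSet {n : ℕ} (K : Set (EuclideanSpace ℝ (Fin n))) : Prop :=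
  IsCompact K ∧
    ∀ v : EuclideanSpace ℝ (Fin n), ‖v‖ = 1 →
      ∃ x : EuclideanSpace ℝ (Fin n), ∀ t ∈ Set.Icc (0 : ℝ) 1, x + t • v ∈ K

/-- A monic real polynomial of odd degree has a real root. -/
theorem Polynomial.Monic.exists_isRoot_of_odd {p : Polynomial ℝ} (hp : p.Monic)
    (hodd : Odd p.natDegree) : ∃ r, p.IsRoot r := by
  have hdeg : 0 < p.degree := Polynomial.natDegree_pos_iff_degree_pos.mp hodd.pos
  have h1 := p.tendsto_atTop_of_leadingCoeff_nonneg hdeg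
    (by rw [hp.leadingCoeff]; exact zero_le_one)
  have hq : (p.comp (-Polynomial.X)).natDegree = p.natDegree := by
    rw [Polynomial.natDegree_comp]; simp
  have h2 := (p.comp (-Polynomial.X)).tendsto_atBot_of_leadingCoeff_nonpos
    (Polynomial.natDegree_pos_iff_degree_pos.mp (hq ▸ hodd.pos)) (by
      rw [Polynomial.leadingCoeff_comp (by simp), hp.leadingCoeff]
      simp [hodd.neg_one_pow])
  obtain ⟨a, ha⟩ := (h1.eventually_ge_atTop 0).exists
  obtain ⟨b, hb⟩ := (h2.eventually_le_atBot 0).exists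
  obtain ⟨r, hr⟩ := mem_range_of_exists_le_of_exists_ge p.continuous
    ⟨-b, by simpa using hb⟩ ⟨a, ha⟩
  exact ⟨r, hr⟩

/-- An endomorphism of a real vector space of odd dimension has a real eigenvalue. -/
theorem Module.End.exists_hasEigenvalue_of_odd_finrank {V : Type*} [AddCommGroup V] [Module ℝ V]
    (hV : Odd (Module.finrank ℝ V)) (f : Module.End ℝ V) : ∃ μ, f.HasEigenvalue μ := by
  have : FiniteDimensional ℝ V := Module.finite_of_finrank_pos hV.pos
  obtain ⟨μ, hμ⟩ := (LinearMap.charpoly_monic f).exists_isRoot_of_odd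
    (by rwa [LinearMap.charpoly_natDegree])
  exact ⟨μ, (Module.End.hasEigenvalue_iff_isRoot_charpoly f μ).mpr hμ⟩

/-- A module of odd real dimension over a commutative real algebra contains a common
eigenvector for the action of the algebra. -/
theorem exists_common_eigenvector_of_odd_finrank {A : Type*} [CommRing A] [Algebra ℝ A] (d : ℕ) :
    ∀ (V : Type*) [AddCommGroup V] [Module ℝ V] [Module A V] [IsScalarTower ℝ A V],
      Module.finrank ℝ V = d → Odd d → ∃ v : V, v ≠ 0 ∧ ∀ a : A, ∃ μ : ℝ, a • v = μ • v := by
  induction d using Nat.strong_induction_on with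
  | _ d ih =>
    intro V _ _ _ _ hd hodd
    have : FiniteDimensional ℝ V := Module.finite_of_finrank_pos (hd ▸ hodd.pos)
    by_cases hsc : ∀ a : A, ∃ μ : ℝ, ∀ v : V, a • v = μ • v
    · have : Nontrivial V := Module.nontrivial_of_finrank_pos (R := ℝ) (hd ▸ hodd.pos)
      obtain ⟨v, hv⟩ := exists_ne (0 : V)
      exact ⟨v, hv, fun a => (hsc a).imp fun μ h => h v⟩
    · push Not at hsc
      obtain ⟨a, ha⟩ := hsc
      obtain ⟨μ, hμ⟩ := Module.End.exists_hasEigenvalue_of_odd_finrank (hd ▸ hodd)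
        ((LinearMap.lsmul A V a).restrictScalars ℝ)
      obtain ⟨w, hw⟩ := hμ.exists_hasEigenvector
      have hw1 : a • w = μ • w := hw.apply_eq_smul
      let T : V →ₗ[A] V := LinearMap.lsmul A V (a - algebraMap ℝ A μ)
      have hT : ∀ v, T v = a • v - μ • v := fun v => by simp [T]
      have hsum : Module.finrank ℝ (LinearMap.range T) + Module.finrank ℝ (LinearMap.ker T) = d :=
        hd ▸ (T.restrictScalars ℝ).finrank_range_add_finrank_ker
      have hkpos : 0 < Module.finrank ℝ (LinearMap.ker T) := by
        have : FiniteDimensional ℝ (LinearMap.ker T) :=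
          inferInstanceAs (FiniteDimensional ℝ (LinearMap.ker (T.restrictScalars ℝ)))
        have : Nontrivial (LinearMap.ker T) :=
          ⟨⟨⟨w, by simp [hT, hw1]⟩, 0, fun h => hw.2 (congrArg Subtype.val h)⟩⟩
        exact Module.finrank_pos
      have hrpos : 0 < Module.finrank ℝ (LinearMap.range T) := by
        have : FiniteDimensional ℝ (LinearMap.range T) :=
          inferInstanceAs (FiniteDimensional ℝ (LinearMap.range (T.restrictScalars ℝ)))
        obtain ⟨u, hu⟩ := ha μ
        have : Nontrivial (LinearMap.range T) :=
          ⟨⟨⟨T u, ⟨u, rfl⟩⟩, 0, fun h => hu (sub_eq_zero.mp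
            ((hT u).symm.trans (congrArg Subtype.val h)))⟩⟩
        exact Module.finrank_pos
      have key : ∃ W : Submodule A V, Module.finrank ℝ W < d ∧ Odd (Module.finrank ℝ W) := by
        rcases Nat.even_or_odd (Module.finrank ℝ (LinearMap.ker T)) with h | h
        · refine ⟨LinearMap.range T, by omega, ?_⟩
          by_contra h'
          rw [Nat.not_odd_iff_even] at h'
          exact (Nat.not_even_iff_odd.mpr hodd) (hsum ▸ h'.add h)
        · exact ⟨LinearMap.ker T, by omega, h⟩
      obtain ⟨W, hWd, hWodd⟩ := key
      obtain ⟨v, hv, hve⟩ := ih _ hWd W rfl hWodd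
      refine ⟨v, by simpa using hv, fun b => ?_⟩
      obtain ⟨ν, hν⟩ := hve b
      exact ⟨ν, by simpa using congrArg Subtype.val hν⟩

/-- A system of real polynomials whose quotient algebra has odd dimension has a real zero. -/
theorem MvPolynomial.exists_common_zero_of_odd_finrank {σ : Type*}
    (I : Ideal (MvPolynomial σ ℝ)) (h : Odd (Module.finrank ℝ (MvPolynomial σ ℝ ⧸ I))) :
    ∃ x : σ → ℝ, ∀ p ∈ I, MvPolynomial.eval x p = 0 := by
  obtain ⟨v, hv, hve⟩ := exists_common_eigenvector_of_odd_finrank (A := MvPolynomial σ ℝ) _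
    (MvPolynomial σ ℝ ⧸ I) rfl h
  choose μ hμ using hve
  have key : ∀ p : MvPolynomial σ ℝ, p • v = MvPolynomial.eval (fun i => μ (X i)) p • v := by
    intro p
    induction p using MvPolynomial.induction_on with
    | C a => rw [← MvPolynomial.algebraMap_eq, algebraMap_smul]; simp
    | add p q hp hq => rw [add_smul, hp, hq, map_add, add_smul]
    | mul_X p i hp =>
      rw [mul_smul, hμ, smul_comm, hp, smul_smul, map_mul, eval_X, mul_comm]
  refine ⟨fun i => μ (X i), fun p hp => ?_⟩
  have h0 : p • v = 0 := by
    obtain ⟨q, rfl⟩ := Ideal.Quotient.mk_surjective v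
    exact Ideal.Quotient.eq_zero_iff_mem.mpr (I.mul_mem_right q hp)
  rw [key] at h0
  exact (smul_eq_zero.mp h0).resolve_right hv

namespace MvPolynomial

variable {n : ℕ} {R : Type*} [CommRing R]

/-- The polynomial `X i ^ d + s * f i`. -/
noncomputable def deformedPower (d : ℕ) (f : Fin n → MvPolynomial (Fin n) R) (s : R) (i : Fin n) :
    MvPolynomial (Fin n) R :=
  X i ^ d + C s * f i

/-- The product of the `X i ^ (e i % d) * (X i ^ d + s * f i) ^ (e i / d)`, a deformation of the
monomial with exponent `e`. -/
noncomputable def deformedMonomial (d : ℕ) (f : Fin n → MvPolynomial (Fin n) R) (s : R)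
    (e : Fin n →₀ ℕ) : MvPolynomial (Fin n) R :=
  ∏ i, X i ^ (e i % d) * deformedPower d f s i ^ (e i / d)

theorem deformedMonomial_zero (d : ℕ) (f : Fin n → MvPolynomial (Fin n) R) (e : Fin n →₀ ℕ) :
    deformedMonomial d f 0 e = monomial e 1 := by
  rw [monomial_eq, Finsupp.prod_fintype _ _ (by simp)]
  simp [deformedMonomial, deformedPower, ← pow_mul, ← pow_add, Nat.mod_add_div]

theorem map_deformedMonomial {S : Type*} [CommRing S] (φ : R →+* S) (d : ℕ)
    (f : Fin n → MvPolynomial (Fin n) R) (s : R) (e : Fin n →₀ ℕ) :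
    map φ (deformedMonomial d f s e) = deformedMonomial d (fun i => map φ (f i)) (φ s) e := by
  simp [deformedMonomial, deformedPower]

theorem deformedMonomial_mul_deformedPower {d : ℕ} (hd : 0 < d)
    (f : Fin n → MvPolynomial (Fin n) R) (s : R) (e : Fin n →₀ ℕ) (i : Fin n) :
    deformedMonomial d f s e * deformedPower d f s i =
      deformedMonomial d f s (e + Finsupp.single i d) := by
  unfold deformedMonomial
  rw [← Finset.mul_prod_erase _ _ (Finset.mem_univ i),
    ← Finset.mul_prod_erase _ (fun j => X j ^ ((e + Finsupp.single i d) j % d) *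
      deformedPower d f s j ^ ((e + Finsupp.single i d) j / d)) (Finset.mem_univ i)]
  have h : ∀ j ∈ Finset.univ.erase i, X j ^ ((e + Finsupp.single i d) j % d) *
      deformedPower d f s j ^ ((e + Finsupp.single i d) j / d) =
        X j ^ (e j % d) * deformedPower d f s j ^ (e j / d) := by
    intro j hj
    rw [Finsupp.add_apply, Finsupp.single_eq_of_ne (Finset.ne_of_mem_erase hj), add_zero]
  rw [Finset.prod_congr rfl h]
  simp only [Finsupp.add_apply, Finsupp.single_eq_same, Nat.add_mod_right,
    Nat.add_div_right _ hd, pow_succ]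
  ring

theorem totalDegree_deformedMonomial_le {d : ℕ} {f : Fin n → MvPolynomial (Fin n) R}
    (hf : ∀ i, (f i).totalDegree ≤ d) (s : R) (e : Fin n →₀ ℕ) :
    (deformedMonomial d f s e).totalDegree ≤ e.degree := by
  rw [Finsupp.degree_eq_sum]
  refine (totalDegree_finsetProd _ _).trans (Finset.sum_le_sum fun i _ => ?_)
  have hX : ∀ m, (X i ^ m : MvPolynomial (Fin n) R).totalDegree ≤ m := fun m => by
    rw [X_pow_eq_monomial]
    exact (totalDegree_monomial_le _ _).trans (by simp)
  have hp : (deformedPower d f s i).totalDegree ≤ d :=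
    (totalDegree_add _ _).trans (max_le (hX d)
      ((totalDegree_mul _ _).trans (by simpa using hf i)))
  calc _ ≤ e i % d + e i / d * d :=
        (totalDegree_mul _ _).trans (add_le_add (hX _)
          ((totalDegree_pow _ _).trans (Nat.mul_le_mul_left _ hp)))
    _ = e i := Nat.mod_add_div' _ _

/-- For all but countably many parameters, the deformed monomials form a basis. -/
theorem exists_countable_basis_deformedMonomial {d : ℕ} {f : Fin n → MvPolynomial (Fin n) ℝ}
    (hf : ∀ i, (f i).totalDegree ≤ d) :
    ∃ S : Set ℝ, S.Countable ∧ ∀ s ∉ S,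
      ∃ b : Module.Basis (Fin n →₀ ℕ) ℝ (MvPolynomial (Fin n) ℝ),
        ∀ e, b e = deformedMonomial d f s e := by
  classical
  have hfin : ∀ k : ℕ, Finite {e : Fin n →₀ ℕ // e.degree ≤ k} := fun k =>
    Set.Finite.subset (Set.finite_Iic (Finsupp.equivFunOnFinite.symm fun _ => k)) fun e he i =>
      (Finsupp.le_degree i e).trans he
  have hft : ∀ k : ℕ, Fintype {e : Fin n →₀ ℕ // e.degree ≤ k} := fun k => Fintype.ofFinite _
  let M : ∀ k : ℕ, Matrix {e : Fin n →₀ ℕ // e.degree ≤ k} {e : Fin n →₀ ℕ // e.degree ≤ k}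
      (Polynomial ℝ) := fun k => Matrix.of fun e e' =>
    coeff e'.1 (deformedMonomial d (fun i => map Polynomial.C (f i)) Polynomial.X e.1)
  let N : ℝ → ∀ k : ℕ, Matrix {e : Fin n →₀ ℕ // e.degree ≤ k} {e : Fin n →₀ ℕ // e.degree ≤ k}
      ℝ := fun s k => Matrix.of fun e e' => coeff e'.1 (deformedMonomial d f s e.1)
  have hMN : ∀ s k, (M k).det.eval s = (N s k).det := by
    intro s k
    rw [← Polynomial.coe_evalRingHom, RingHom.map_det]
    congr 1
    ext e e'
    have hC : (Polynomial.evalRingHom s).comp Polynomial.C = RingHom.id ℝ := by ext; simp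
    simp only [M, N, RingHom.mapMatrix_apply, Matrix.map_apply, Matrix.of_apply, ← coeff_map,
      map_deformedMonomial, map_map, hC, map_id]
    simp
  have hdet : ∀ k, (M k).det ≠ 0 := by
    intro k h
    have h0 := hMN 0 k
    have : N 0 k = 1 := by
      ext e e'
      simp only [N, Matrix.of_apply, deformedMonomial_zero, coeff_monomial, Matrix.one_apply,
        Subtype.ext_iff]
    rw [h, this] at h0
    simp at h0
  refine ⟨⋃ k, {s | (M k).det.IsRoot s}, Set.countable_iUnion fun k =>
    (Polynomial.finite_setOfPred_isRoot (hdet k)).countable, fun s hs => ?_⟩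
  have hN : ∀ k, IsUnit (N s k).det := by
    intro k
    rw [isUnit_iff_ne_zero, ← hMN]
    exact fun h => hs (Set.mem_iUnion.mpr ⟨k, h⟩)
  let L := (basisMonomials (Fin n) ℝ).constr ℝ (deformedMonomial d f s)
  have hL : ∀ e, L (monomial e 1) = deformedMonomial d f s e := fun e => by
    simpa using (basisMonomials (Fin n) ℝ).constr_basis ℝ (deformedMonomial d f s) e
  have hinj : Function.Injective L := by
    rw [← LinearMap.ker_eq_bot, LinearMap.ker_eq_bot']
    intro p hp
    set k := p.totalDegree
    have hsum : p = ∑ e : {e : Fin n →₀ ℕ // e.degree ≤ k}, coeff e.1 p • monomial e.1 1 := by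
      ext m
      simp only [coeff_sum, coeff_smul, coeff_monomial, smul_eq_mul, mul_ite, mul_one, mul_zero]
      by_cases hm : m.degree ≤ k
      · rw [Finset.sum_eq_single ⟨m, hm⟩] <;> aesop
      · rw [coeff_eq_zero_of_totalDegree_lt (not_le.mp hm),
          Finset.sum_eq_zero]
        rintro ⟨e, he⟩ -
        rw [if_neg]
        rintro rfl
        exact hm he
    have hv : Matrix.vecMul (fun e : {e : Fin n →₀ ℕ // e.degree ≤ k} => coeff e.1 p) (N s k)
        = 0 := by
      ext e'
      have := congrArg (coeff e'.1) hp
      rw [hsum, map_sum] at this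
      simpa [Matrix.vecMul, dotProduct, N, hL, coeff_sum] using this
    have := Matrix.eq_zero_of_vecMul_eq_zero (hN k).ne_zero hv
    rw [hsum]
    exact Finset.sum_eq_zero fun e _ => by rw [congrFun this e]; simp
  have hsurj : Function.Surjective L := by
    rw [← LinearMap.range_eq_top, eq_top_iff, ← (basisMonomials (Fin n) ℝ).span_eq,
      Submodule.span_le]
    rintro _ ⟨m, rfl⟩
    refine ⟨∑ e, (N s m.degree)⁻¹ ⟨m, le_rfl⟩ e • monomial e.1 1, ?_⟩
    ext m'
    simp only [map_sum, map_smul, hL, coeff_sum, coeff_smul, coe_basisMonomials, coeff_monomial]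
    by_cases hm : m'.degree ≤ m.degree
    · have := congrFun (congrFun (Matrix.nonsing_inv_mul _ (hN m.degree)) ⟨m, le_rfl⟩) ⟨m', hm⟩
      simpa [Matrix.mul_apply, Matrix.one_apply, N] using this
    · rw [if_neg (by rintro rfl; exact hm le_rfl)]
      refine Finset.sum_eq_zero fun e _ => ?_
      rw [coeff_eq_zero_of_totalDegree_lt, smul_zero]
      exact ((totalDegree_deformedMonomial_le hf s e.1).trans e.2).trans_lt
        (not_le.mp hm)
  exact ⟨(basisMonomials (Fin n) ℝ).map (LinearEquiv.ofBijective L ⟨hinj, hsurj⟩), fun e => by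
    rw [Module.Basis.map_apply, coe_basisMonomials]; exact hL e⟩

/-- If the deformed monomials form a basis, then the quotient by the deformed powers has
dimension `d ^ n`. -/
theorem finrank_quotient_deformedPower {d : ℕ} (hd : 0 < d)
    {f : Fin n → MvPolynomial (Fin n) ℝ} {s : ℝ}
    (b : Module.Basis (Fin n →₀ ℕ) ℝ (MvPolynomial (Fin n) ℝ))
    (hb : ∀ e, b e = deformedMonomial d f s e) :
    Module.finrank ℝ (MvPolynomial (Fin n) ℝ ⧸ Ideal.span (Set.range (deformedPower d f s))) =
      d ^ n := by
  set I := Ideal.span (Set.range (deformedPower d f s))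
  let toExp : (Fin n → Fin d) → (Fin n →₀ ℕ) := fun a =>
    Finsupp.equivFunOnFinite.symm fun i => (a i : ℕ)
  have htoExp : ∀ a i, toExp a i = a i := fun a i => rfl
  let φ : MvPolynomial (Fin n) ℝ →ₗ[ℝ] ((Fin n → Fin d) → ℝ) :=
    LinearMap.pi fun a => b.coord (toExp a)
  have hφ : ∀ p a, φ p a = b.repr p (toExp a) := fun p a => rfl
  have hφb : ∀ e a, φ (b e) a = if e = toExp a then 1 else 0 := fun e a => by
    rw [hφ, Module.Basis.repr_self, Finsupp.single_apply]
  have hsurj : Function.Surjective φ := by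
    intro c
    refine ⟨∑ a, c a • b (toExp a), ?_⟩
    ext a
    have hinj : ∀ a', toExp a' = toExp a ↔ a' = a := fun a' => by
      refine ⟨fun h => ?_, fun h => by rw [h]⟩
      ext i
      exact DFunLike.congr_fun h i
    simp [hφb, hinj]
  have hker : LinearMap.ker φ = I.restrictScalars ℝ := by
    apply le_antisymm
    · intro p hp
      rw [← b.linearCombination_repr p, Finsupp.linearCombination_apply]
      refine Submodule.sum_mem _ fun e _ => ?_
      by_cases he : ∀ i, e i < d
      · have h0 : b.repr p e = 0 := by
          have h1 : φ p (fun i => ⟨e i, he i⟩) = 0 := congrFun hp _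
          rwa [hφ, show toExp (fun i => ⟨e i, he i⟩) = e from Finsupp.ext fun i => rfl] at h1
        simp [h0]
      · push Not at he
        obtain ⟨i, hi⟩ := he
        refine Submodule.smul_mem _ _ ?_
        have : e = (e - Finsupp.single i d) + Finsupp.single i d :=
          (tsub_add_cancel_of_le (by simpa using hi)).symm
        rw [hb, this, ← deformedMonomial_mul_deformedPower hd]
        exact I.mul_mem_left _ (Ideal.subset_span ⟨i, rfl⟩)
    · have hmul : ∀ i p, φ (p * deformedPower d f s i) = 0 := by
        intro i p
        rw [← b.linearCombination_repr p, Finsupp.linearCombination_apply, Finsupp.sum,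
          Finset.sum_mul, map_sum]
        refine Finset.sum_eq_zero fun e _ => ?_
        rw [smul_mul_assoc, hb, deformedMonomial_mul_deformedPower hd, ← hb, map_smul]
        ext a
        rw [Pi.smul_apply, hφb, if_neg]
        · simp
        · intro h
          have := (a i).2
          have h2 := DFunLike.congr_fun h i
          rw [htoExp, Finsupp.add_apply, Finsupp.single_eq_same] at h2
          omega
      have hall : ∀ p ∈ I, ∀ q, φ (q * p) = 0 := by
        intro p hp
        induction hp using Submodule.span_induction with
        | mem x hx =>
          obtain ⟨i, rfl⟩ := hx
          exact hmul i
        | zero => simp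
        | add x y _ _ h1 h2 => intro q; rw [mul_add, map_add, h1, h2, add_zero]
        | smul a x _ h => intro q; rw [smul_eq_mul, ← mul_assoc]; exact h _
      intro p hp
      simpa using hall p hp 1
  rw [← (Submodule.Quotient.restrictScalarsEquiv ℝ I).finrank_eq, ← hker,
    (φ.quotKerEquivOfSurjective hsurj).finrank_eq]
  simp

/-- For arbitrarily large parameters, the deformed powers of odd degree have a common real
zero. -/
theorem exists_common_zero_deformedPower {d : ℕ} (hd : Odd d)
    {f : Fin n → MvPolynomial (Fin n) ℝ} (hf : ∀ i, (f i).totalDegree ≤ d) (r : ℝ) :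
    ∃ s > r, ∃ x : Fin n → ℝ, ∀ i, x i ^ d + s * eval x (f i) = 0 := by
  obtain ⟨S, hS, hbasis⟩ := exists_countable_basis_deformedMonomial hf
  obtain ⟨s, hs, hsS⟩ := (hS.dense_compl ℝ).exists_mem_open isOpen_Ioi (Set.nonempty_Ioi (a := r))
  obtain ⟨b, hb⟩ := hbasis s hs
  obtain ⟨x, hx⟩ := exists_common_zero_of_odd_finrank
    (Ideal.span (Set.range (deformedPower d f s)))
    (by rw [finrank_quotient_deformedPower hd.pos b hb]; exact hd.pow)
  refine ⟨s, hsS, x, fun i => ?_⟩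
  simpa [deformedPower] using hx _ (Ideal.subset_span ⟨i, rfl⟩)

end MvPolynomial

namespace MvPolynomial

theorem IsHomogeneous.eval_smul {σ R : Type*} [CommSemiring R] {p : MvPolynomial σ R} {d : ℕ}
    (hp : p.IsHomogeneous d) (r : R) (x : σ → R) : eval (r • x) p = r ^ d * eval x p := by
  rw [eval_eq, eval_eq, Finset.mul_sum]
  refine Finset.sum_congr rfl fun e he => ?_
  have hdeg : d = ∑ i ∈ e.support, e i := hp.degree_eq_sum_deg_support he
  simp only [Pi.smul_apply, smul_eq_mul, mul_pow, Finset.prod_mul_distrib,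
    Finset.prod_pow_eq_pow_sum,
    ← hdeg]
  ring

theorem totalDegree_aeval_le {σ τ R : Type*} [CommSemiring R] (g : σ → MvPolynomial τ R)
    (hg : ∀ i, (g i).totalDegree ≤ 1) (p : MvPolynomial σ R) :
    (aeval g p).totalDegree ≤ p.totalDegree := by
  rw [aeval_def, eval₂_eq]
  refine totalDegree_finsetSum_le fun e he => ?_
  refine (totalDegree_mul _ _).trans ?_
  rw [algebraMap_eq, totalDegree_C, zero_add]
  refine (totalDegree_finsetProd _ _).trans (le_trans ?_ (le_totalDegree he))
  exact Finset.sum_le_sum fun i _ =>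
    (totalDegree_pow _ _).trans ((Nat.mul_le_mul_left _ (hg i)).trans_eq (mul_one _))

/-- A system of `m` real forms of the same odd degree in `m + 1` variables is arbitrarily small
somewhere on the unit sphere. -/
theorem exists_abs_eval_le_of_isHomogeneous {m d : ℕ} (hd : Odd d)
    {F : Fin m → MvPolynomial (Fin (m + 1)) ℝ} (hF : ∀ i, (F i).IsHomogeneous d)
    {η : ℝ} (hη : 0 < η) :
    ∃ y : Fin (m + 1) → ℝ, ∑ i, y i ^ 2 = 1 ∧ ∀ i, |eval y (F i)| ≤ η := by
  let g : Fin (m + 1) → MvPolynomial (Fin m) ℝ := Fin.cons 1 X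
  have hg : ∀ i, (g i).totalDegree ≤ 1 := by
    refine Fin.cases ?_ fun i => ?_
    · simp [g]
    · simp [g, totalDegree_X]
  obtain ⟨s, hs, x, hx⟩ := exists_common_zero_deformedPower hd (f := fun i => aeval g (F i))
    (fun i => (totalDegree_aeval_le g hg _).trans (hF i).totalDegree_le) η⁻¹
  have hs0 : 0 < s := (inv_pos.mpr hη).trans hs
  set z : Fin (m + 1) → ℝ := Fin.cons 1 x
  have hz : ∀ p : MvPolynomial (Fin (m + 1)) ℝ, eval x (aeval g p) = eval z p := by
    intro p
    have hgz : ∀ i, eval x (g i) = z i := Fin.cases (by simp [g, z]) fun i => by simp [g, z]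
    induction p using MvPolynomial.induction_on with
    | C a => simp
    | add p q hp hq => rw [map_add, map_add, map_add, hp, hq]
    | mul_X p i hp => rw [map_mul, map_mul, map_mul, hp, aeval_X, hgz, eval_X]
  set q := ∑ i, z i ^ 2
  have hq : 0 < q := by
    refine lt_of_lt_of_le one_pos ?_
    simp only [q, Fin.sum_univ_succ, z, Fin.cons_zero, one_pow, le_add_iff_nonneg_right]
    exact Finset.sum_nonneg fun i _ => sq_nonneg _
  set r := (√q)⁻¹
  have hr0 : 0 < r := inv_pos.mpr (Real.sqrt_pos.mpr hq)
  have hr2 : r ^ 2 * q = 1 := by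
    rw [inv_pow, Real.sq_sqrt hq.le, inv_mul_cancel₀ hq.ne']
  have hsum : ∑ i, (r • z) i ^ 2 = 1 := by
    simp only [Pi.smul_apply, smul_eq_mul, mul_pow, ← Finset.mul_sum]
    exact hr2
  refine ⟨r • z, hsum, fun i => ?_⟩
  have h1 : s * eval (r • z) (F i) = - ((r • z) i.succ) ^ d := by
    have := hx i
    simp only [hz] at this
    rw [(hF i).eval_smul, Pi.smul_apply, smul_eq_mul, mul_pow]
    simp only [z, Fin.cons_succ] at this ⊢
    linear_combination r ^ d * this
  have h2 : |(r • z) i.succ| ≤ 1 := by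
    rw [← sq_le_one_iff_abs_le_one, ← hsum]
    exact Finset.single_le_sum (f := fun i => (r • z) i ^ 2) (fun i _ => sq_nonneg _)
      (Finset.mem_univ _)
  have h3 : s * |eval (r • z) (F i)| ≤ 1 := by
    rw [← abs_of_pos hs0, ← abs_mul, h1, abs_neg, abs_pow]
    exact pow_le_one₀ (abs_nonneg _) h2
  have h4 : 1 ≤ η * s := by
    rw [← mul_inv_cancel₀ hη.ne']
    exact mul_le_mul_of_nonneg_left hs.le hη.le
  nlinarith [abs_nonneg (eval (r • z) (F i))]

/-- Real polynomials are dense among the continuous functions on a compact subset of `σ → ℝ`. -/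
theorem exists_eval_near_of_continuousOn {σ : Type*} {K : Set (σ → ℝ)} (hK : IsCompact K)
    {f : (σ → ℝ) → ℝ} (hf : ContinuousOn f K) {η : ℝ} (hη : 0 < η) :
    ∃ p : MvPolynomial σ ℝ, ∀ x ∈ K, |eval x p - f x| < η := by
  have : CompactSpace K := isCompact_iff_compactSpace.mp hK
  let φ : MvPolynomial σ ℝ →ₐ[ℝ] C(K, ℝ) :=
    aeval fun i => ⟨fun x => x.1 i, (continuous_apply i).comp continuous_subtype_val⟩
  have hφ : ∀ p (x : K), φ p x = eval x.1 p := by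
    intro p x
    induction p using MvPolynomial.induction_on with
    | C a => simp [φ]
    | add p q hp hq => simp [hp, hq]
    | mul_X p i hp => simp [hp, φ]
  have hsep : φ.range.SeparatesPoints := by
    intro x y hxy
    obtain ⟨i, hi⟩ := Function.ne_iff.mp (Subtype.coe_ne_coe.mpr hxy)
    exact ⟨φ (X i), ⟨φ (X i), ⟨X i, rfl⟩, rfl⟩, by simpa [hφ] using hi⟩
  obtain ⟨⟨_, p, rfl⟩, hp⟩ :=
    ContinuousMap.exists_mem_subalgebra_near_continuous_of_separatesPoints φ.range hsep
      (K.domRestrict f) hf.domRestrict η hη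
  refine ⟨p, fun x hx => ?_⟩
  have := hp ⟨x, hx⟩
  rw [Real.norm_eq_abs] at this
  rw [← hφ p ⟨x, hx⟩]
  exact this

/-- On the unit sphere, the odd part of a polynomial is given by a form of odd degree. -/
theorem exists_isHomogeneous_eval_eq_odd_part {σ : Type*} [Fintype σ] (p : MvPolynomial σ ℝ)
    {k : ℕ} (hk : p.totalDegree ≤ k) :
    ∃ F : MvPolynomial σ ℝ, F.IsHomogeneous (2 * k + 1) ∧
      ∀ x : σ → ℝ, ∑ i, x i ^ 2 = 1 → eval x F = (eval x p - eval (-x) p) / 2 := by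
  refine ⟨∑ j ∈ Finset.range (k + 1), homogeneousComponent (2 * j + 1) p *
    (∑ i, X i ^ 2) ^ (k - j), IsHomogeneous.sum _ _ _ fun j hj => ?_, fun x hx => ?_⟩
  · have h1 : (∑ i, X i ^ 2 : MvPolynomial σ ℝ).IsHomogeneous 2 :=
      IsHomogeneous.sum _ _ _ fun i _ => isHomogeneous_X_pow i 2
    have h2 := (homogeneousComponent_isHomogeneous (2 * j + 1) p).mul (h1.pow (k - j))
    have hj' := Finset.mem_range.mp hj
    rwa [show 2 * j + 1 + 2 * (k - j) = 2 * k + 1 by omega] at h2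
  · have hp : p = ∑ j ∈ Finset.range (2 * (k + 1)), homogeneousComponent j p := by
      conv_lhs => rw [← sum_homogeneousComponent p]
      refine Finset.sum_subset (Finset.range_mono (by omega)) fun j _ hj => ?_
      exact homogeneousComponent_eq_zero _ _ (by simpa using hj)
    have hneg : ∀ j, eval (-x) (homogeneousComponent j p) =
        (-1) ^ j * eval x (homogeneousComponent j p) := fun j => by
      rw [← (homogeneousComponent_isHomogeneous j p).eval_smul, neg_one_smul]
    have hsplit : ∀ (a : ℕ → ℝ) (m : ℕ), ∑ j ∈ Finset.range (2 * m), (a j - (-1) ^ j * a j) =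
        2 * ∑ j ∈ Finset.range m, a (2 * j + 1) := by
      intro a m
      induction m with
      | zero => simp
      | succ m ih =>
        rw [mul_add, mul_one, Finset.sum_range_succ, Finset.sum_range_succ, ih,
          Finset.sum_range_succ _ m]
        simp [pow_succ]
        ring
    have h1 : eval x p - eval (-x) p =
        2 * ∑ j ∈ Finset.range (k + 1), eval x (homogeneousComponent (2 * j + 1) p) := by
      rw [← hsplit fun j => eval x (homogeneousComponent j p)]
      conv_lhs => rw [hp]
      rw [map_sum, map_sum, ← Finset.sum_sub_distrib]
      exact Finset.sum_congr rfl fun j _ => by rw [hneg]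
    rw [h1, map_sum, mul_div_cancel_left₀ _ two_ne_zero]
    refine Finset.sum_congr rfl fun j _ => ?_
    simp [hx]

end MvPolynomial

/-- The **Borsuk-Ulam theorem**: an odd continuous map from the unit sphere of `ℝ^(m+1)` to `ℝ^m`
has a zero. -/
theorem exists_eq_zero_of_odd_of_continuousOn_sphere {m : ℕ}
    {f : (Fin (m + 1) → ℝ) → Fin m → ℝ} (hodd : ∀ x, f (-x) = -f x)
    (hf : ContinuousOn f {x | ∑ i, x i ^ 2 = 1}) :
    ∃ x : Fin (m + 1) → ℝ, ∑ i, x i ^ 2 = 1 ∧ f x = 0 := by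
  set S : Set (Fin (m + 1) → ℝ) := {x | ∑ i, x i ^ 2 = 1} with hS
  have hcomp : IsCompact S := by
    refine Metric.isCompact_of_isClosed_isBounded
      (isClosed_eq (by fun_prop) continuous_const) ?_
    refine (isBounded_iff_forall_norm_le).mpr ⟨1, fun x hx => ?_⟩
    refine (pi_norm_le_iff_of_nonneg zero_le_one).mpr fun i => ?_
    rw [Real.norm_eq_abs, ← sq_le_one_iff_abs_le_one, ← show ∑ i, x i ^ 2 = 1 from hx]
    exact Finset.single_le_sum (f := fun i => x i ^ 2) (fun i _ => sq_nonneg _)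
      (Finset.mem_univ _)
  have hne : S.Nonempty := ⟨Pi.single 0 1, by
    simp [hS, Pi.single_apply]⟩
  obtain ⟨x, hxS, hmin⟩ := hcomp.exists_isMinOn hne hf.norm
  refine ⟨x, hxS, ?_⟩
  by_contra hx
  have hpos : 0 < ‖f x‖ := norm_pos_iff.mpr hx
  set η := ‖f x‖ / 3 with hη
  have hη0 : 0 < η := by positivity
  choose p hp using fun i => MvPolynomial.exists_eval_near_of_continuousOn hcomp
    ((continuous_apply i).comp_continuousOn hf) hη0
  choose F hFh hF using fun i => (p i).exists_isHomogeneous_eval_eq_odd_part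
    (Finset.le_sup (f := fun i => (p i).totalDegree) (Finset.mem_univ i))
  obtain ⟨y, hy, hyF⟩ := MvPolynomial.exists_abs_eval_le_of_isHomogeneous
    (odd_two_mul_add_one _) hFh hη0
  have hyS : -y ∈ S := by simpa [hS] using hy
  have hle : ‖f y‖ ≤ 2 * η := by
    refine (pi_norm_le_iff_of_nonneg (by positivity)).mpr fun i => ?_
    have h1 := hp i y hy
    have h2 := hp i (-y) hyS
    have h3 := hyF i
    rw [hF i y hy] at h3
    simp only [Function.comp_apply, hodd, Pi.neg_apply] at h1 h2
    rw [abs_lt] at h1 h2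
    rw [abs_le] at h3
    rw [Real.norm_eq_abs, abs_le]
    constructor <;> linarith
  have := hmin (show y ∈ S from hy)
  simp only [Set.mem_ofPred_eq] at this
  linarith

/-- The zero set of a nonzero real polynomial is a null set. -/
theorem MvPolynomial.volume_zeros_eq_zero {n : ℕ} {p : MvPolynomial (Fin n) ℝ} (hp : p ≠ 0) :
    volume {x : Fin n → ℝ | eval x p = 0} = 0 := by
  induction n with
  | zero =>
    obtain ⟨a, rfl⟩ := C_surjective (Fin 0) p
    have ha : a ≠ 0 := by rintro rfl; simp at hp
    simp [ha]
  | succ n ih =>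
    have hmp := volume_preserving_piFinSuccAbove (fun _ : Fin (n + 1) => ℝ) 0
    let s : Set (ℝ × (Fin n → ℝ)) := {z | eval (Fin.cons z.1 z.2 : Fin (n + 1) → ℝ) p = 0}
    have hs : MeasurableSet s := by
      refine (isClosed_eq (p.continuous_eval.comp ?_) continuous_const).measurableSet
      refine continuous_pi (Fin.cases ?_ fun i => ?_)
      · simpa using continuous_fst
      · simp only [Fin.cons_succ]
        fun_prop
    have hpre : {x : Fin (n + 1) → ℝ | eval x p = 0} =
        MeasurableEquiv.piFinSuccAbove (fun _ : Fin (n + 1) => ℝ) 0 ⁻¹' s := by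
      ext x
      simp [s, MeasurableEquiv.piFinSuccAbove]
    rw [hpre, hmp.measure_preimage hs.nullMeasurableSet, Measure.volume_eq_prod,
      Measure.measure_prod_null hs]
    set q := finSuccEquiv ℝ n p
    have hq : q ≠ 0 := by simpa [q] using hp
    have hfin : {t : ℝ | q.eval (C t) = 0}.Finite :=
      (Polynomial.finite_setOfPred_isRoot hq).preimage (C_injective (Fin n) ℝ).injOn
    refine measure_mono_null (fun t ht => ?_) (hfin.measure_zero volume)
    by_contra h
    refine ht ?_
    have := ih (p := q.eval (C t)) h
    change volume (Prod.mk t ⁻¹' s) = 0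
    rw [← this]
    congr 1
    ext y
    have h2 := Polynomial.eval₂_at_apply (p := q) (eval y) (C t)
    rw [eval_C] at h2
    change eval _ p = 0 ↔ _ = 0
    rw [eval_eq_eval_mv_eval', Polynomial.eval_map, h2]

theorem MvPolynomial.ae_eval_ne_zero {n : ℕ} {p : MvPolynomial (Fin n) ℝ} (hp : p ≠ 0) :
    ∀ᵐ x : EuclideanSpace ℝ (Fin n), eval (fun i => x i) p ≠ 0 := by
  have h := (PiLp.volume_preserving_ofLp (Fin n)).quasiMeasurePreserving.ae
    (p := fun x => eval x p ≠ 0) (by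
      rw [ae_iff]; simpa using volume_zeros_eq_zero hp)
  exact h

theorem MvPolynomial.continuous_eval_euclideanSpace {n : ℕ} (p : MvPolynomial (Fin n) ℝ) :
    Continuous fun x : EuclideanSpace ℝ (Fin n) => eval (fun i => x i) p :=
  p.continuous_eval.comp (by fun_prop)

/-- The **polynomial ham sandwich theorem**: in a space of polynomials spanned by `m + 1`
monomials there is a nonzero polynomial that bisects `m` given sets of finite volume. -/
theorem exists_polynomial_bisecting {n m : ℕ} {e : Fin (m + 1) → (Fin n →₀ ℕ)}
    (he : Function.Injective e) {E : Fin m → Set (EuclideanSpace ℝ (Fin n))}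
    (hE : ∀ j, MeasurableSet (E j)) (hfin : ∀ j, volume (E j) ≠ ∞) :
    ∃ Q : MvPolynomial (Fin n) ℝ, Q ≠ 0 ∧ (∀ a ∈ Q.support, a ∈ Set.range e) ∧
      ∀ j, 2⁻¹ * volume (E j) =
          volume {x ∈ E j | 0 < MvPolynomial.eval (fun i => x i) Q} ∧
        2⁻¹ * volume (E j) =
          volume {x ∈ E j | MvPolynomial.eval (fun i => x i) Q < 0} := by
  classical
  let P : (Fin (m + 1) → ℝ) → MvPolynomial (Fin n) ℝ := fun c =>
    ∑ i, MvPolynomial.monomial (e i) (c i)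
  have hcoeff : ∀ c i, MvPolynomial.coeff (e i) (P c) = c i := by
    intro c i
    simp [P, MvPolynomial.coeff_sum, MvPolynomial.coeff_monomial, he.eq_iff]
  have hP0 : ∀ c, ∑ i, c i ^ 2 = 1 → P c ≠ 0 := by
    intro c hc h
    have : c = 0 := by ext i; rw [← hcoeff c i, h]; simp
    simp [this] at hc
  have hPneg : ∀ c, P (-c) = -P c := by intro c; simp [P]
  have hev : ∀ x : Fin n → ℝ, Continuous fun c => MvPolynomial.eval x (P c) := by
    intro x
    simp only [P, map_sum, MvPolynomial.eval_monomial]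
    fun_prop
  have hsm : Measurable Real.sign :=
    Measurable.ite measurableSet_Iio measurable_const
      (Measurable.ite measurableSet_Ioi measurable_const measurable_const)
  have hsc : ∀ t : ℝ, t ≠ 0 → ContinuousAt Real.sign t := by
    intro t ht
    rcases ht.lt_or_gt with h | h
    · refine (continuousAt_const (y := (-1 : ℝ))).congr ?_
      filter_upwards [Iio_mem_nhds h] with u hu using (Real.sign_of_neg hu).symm
    · refine (continuousAt_const (y := (1 : ℝ))).congr ?_
      filter_upwards [Ioi_mem_nhds h] with u hu using (Real.sign_of_pos hu).symm
  have hsb : ∀ t : ℝ, ‖Real.sign t‖ ≤ 1 := by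
    intro t
    rcases Real.sign_apply_eq t with h | h | h <;> simp [h]
  have hm : ∀ p : MvPolynomial (Fin n) ℝ, Measurable fun x : EuclideanSpace ℝ (Fin n) =>
      Real.sign (MvPolynomial.eval (fun i => x i) p) := fun p =>
    hsm.comp p.continuous_eval_euclideanSpace.measurable
  have hint1 : ∀ j, Integrable (1 : EuclideanSpace ℝ (Fin n) → ℝ) (volume.restrict (E j)) :=
    fun j => integrableOn_const (hfin j)
  obtain ⟨c, hc, hc0⟩ := exists_eq_zero_of_odd_of_continuousOn_sphere
    (f := fun c j => ∫ x in E j, Real.sign (MvPolynomial.eval (fun i => x i) (P c)))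
    (fun c => by ext j; simp [hPneg, Real.sign_neg, integral_neg]) (by
      refine continuousOn_pi.mpr fun j c hc => ?_
      refine continuousWithinAt_of_dominated (bound := fun _ => 1)
        (.of_forall fun c => (hm _).aestronglyMeasurable)
        (.of_forall fun c => .of_forall fun x => hsb _) (hint1 j) ?_
      filter_upwards [ae_restrict_of_ae (MvPolynomial.ae_eval_ne_zero (hP0 c hc))] with x hx
      exact (ContinuousAt.comp (f := fun c => MvPolynomial.eval (fun i => x i) (P c)) (hsc _ hx)
        (hev _).continuousAt).continuousWithinAt)
  refine ⟨P c, hP0 c hc, fun a ha => ?_, fun j => ?_⟩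
  · by_contra h
    refine MvPolynomial.mem_support_iff.mp ha ?_
    rw [MvPolynomial.coeff_sum]
    refine Finset.sum_eq_zero fun i _ => ?_
    rw [MvPolynomial.coeff_monomial, if_neg]
    exact fun hi => h ⟨i, hi⟩
  · set A : Set (EuclideanSpace ℝ (Fin n)) :=
      {x | 0 < MvPolynomial.eval (fun i => x i) (P c)}
    set B : Set (EuclideanSpace ℝ (Fin n)) :=
      {x | MvPolynomial.eval (fun i => x i) (P c) < 0}
    have hA : MeasurableSet A := measurableSet_lt measurable_const
      (P c).continuous_eval_euclideanSpace.measurable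
    have hB : MeasurableSet B := measurableSet_lt
      (P c).continuous_eval_euclideanSpace.measurable measurable_const
    have hdis : Disjoint A B := Set.disjoint_left.mpr fun x hx hx' =>
      lt_asymm (a := (0 : ℝ)) hx hx'
    have hsum : volume (E j) = volume (E j ∩ A) + volume (E j ∩ B) := by
      rw [← measure_union (hdis.mono Set.inter_subset_right Set.inter_subset_right)
        ((hE j).inter hB), ← Set.inter_union_distrib_left]
      refine measure_congr ?_
      filter_upwards [MvPolynomial.ae_eval_ne_zero (hP0 c hc)] with x hx
      refine propext ⟨fun h => ⟨h, ?_⟩, fun h => h.1⟩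
      exact hx.lt_or_gt.symm
    have hzero : volume.real (E j ∩ A) - volume.real (E j ∩ B) = 0 := by
      refine Eq.trans ?_ (congrFun hc0 j)
      rw [Set.inter_comm, Set.inter_comm (E j) B]
      have hsg : ∀ x : EuclideanSpace ℝ (Fin n),
          Real.sign (MvPolynomial.eval (fun i => x i) (P c)) =
            A.indicator (1 : EuclideanSpace ℝ (Fin n) → ℝ) x -
              B.indicator (1 : EuclideanSpace ℝ (Fin n) → ℝ) x := by
        intro x
        have hxA : x ∈ A ↔ 0 < MvPolynomial.eval (fun i => x i) (P c) := Iff.rfl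
        have hxB : x ∈ B ↔ MvPolynomial.eval (fun i => x i) (P c) < 0 := Iff.rfl
        simp only [Set.indicator_apply, hxA, hxB]
        rcases lt_trichotomy (MvPolynomial.eval (fun i => x i) (P c)) 0 with h | h | h
        · simp [Real.sign_of_neg h, h, h.not_gt]
        · simp [h]
        · simp [Real.sign_of_pos h, h, h.not_gt]
      simp only [hsg]
      rw [integral_sub ((hint1 j).indicator hA) ((hint1 j).indicator hB),
        integral_indicator_one hA, integral_indicator_one hB, measureReal_restrict_apply hA,
        measureReal_restrict_apply hB]
    have hfA : volume (E j ∩ A) ≠ ∞ := measure_ne_top_of_subset Set.inter_subset_left (hfin j)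
    have hfB : volume (E j ∩ B) ≠ ∞ := measure_ne_top_of_subset Set.inter_subset_left (hfin j)
    have heq : volume (E j ∩ A) = volume (E j ∩ B) :=
      (measureReal_eq_measureReal_iff hfA hfB).mp (sub_eq_zero.mp hzero)
    have half : ∀ a : ℝ≥0∞, 2⁻¹ * (a + a) = a := fun a => by
      rw [← two_mul, ← mul_assoc, ENNReal.inv_mul_cancel two_ne_zero ofNat_ne_top, one_mul]
    constructor
    · rw [hsum, ← heq, half]; rfl
    · rw [hsum, heq, half]; rfl

theorem measurableSet_gridCube (n : ℕ) (δ : ℝ) (k : Fin n → ℤ) :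
    MeasurableSet (gridCube n δ k) := by
  have : gridCube n δ k = ⋂ i, (fun x : EuclideanSpace ℝ (Fin n) => x i) ⁻¹'
      Set.Icc ((k i : ℝ) * δ) (((k i : ℝ) + 1) * δ) := by
    ext x; simp [gridCube]
  rw [this]
  exact MeasurableSet.iInter fun i => measurableSet_Icc.preimage (by fun_prop)

theorem volume_gridCube_ne_top (n : ℕ) (δ : ℝ) (k : Fin n → ℤ) :
    volume (gridCube n δ k) ≠ ∞ := by
  have : gridCube n δ k = WithLp.ofLp ⁻¹'
      (Set.Icc (fun i => (k i : ℝ) * δ) fun i => ((k i : ℝ) + 1) * δ) := by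
    ext x; simp [gridCube, Pi.le_def, forall_and]
  rw [this, (PiLp.volume_preserving_ofLp (Fin n)).measure_preimage
    measurableSet_Icc.nullMeasurableSet]
  exact isCompact_Icc.measure_lt_top.ne

/-- Fewer than `(d + 1) ^ n` grid cubes are roughly bisected by a polynomial of degree `n * d`. -/
theorem exists_roughlyBisected_gridCube {n d : ℕ} (δ : ℝ) {S : Finset (Fin n → ℤ)}
    (hS : S.card < (d + 1) ^ n) :
    ∃ Q : MvPolynomial (Fin n) ℝ, Q ≠ 0 ∧ Q.totalDegree ≤ n * d ∧
      ∀ k ∈ S, RoughlyBisected Q (gridCube n δ k) := by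
  have hcard : Fintype.card (Fin (S.card + 1)) ≤ Fintype.card (Fin n → Fin (d + 1)) := by
    simpa using hS
  obtain ⟨g⟩ := Function.Embedding.nonempty_of_card_le hcard
  let e : Fin (S.card + 1) → (Fin n →₀ ℕ) := fun j =>
    Finsupp.equivFunOnFinite.symm fun i => (g j i : ℕ)
  have he : Function.Injective e := by
    intro a b hab
    refine g.injective (funext fun i => Fin.ext ?_)
    exact DFunLike.congr_fun hab i
  obtain ⟨Q, hQ, hsupp, hbis⟩ := exists_polynomial_bisecting he
    (fun j => measurableSet_gridCube n δ (S.equivFin.symm j))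
    (fun j => volume_gridCube_ne_top n δ (S.equivFin.symm j))
  refine ⟨Q, hQ, Finset.sup_le fun a ha => ?_, fun k hk => ?_⟩
  · obtain ⟨j, rfl⟩ := hsupp a ha
    rw [Finsupp.sum_fintype _ _ fun _ => rfl]
    refine (Finset.sum_le_card_nsmul _ _ d fun i _ => ?_).trans (by simp)
    exact Nat.lt_succ_iff.mp (g j i).is_lt
  · have h := hbis (S.equivFin ⟨k, hk⟩)
    rw [Equiv.symm_apply_apply] at h
    have h10 : (10 : ℝ≥0∞)⁻¹ * volume (gridCube n δ k) ≤ 2⁻¹ * volume (gridCube n δ k) := by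
      gcongr
      norm_num
    exact ⟨h10.trans h.1.le, h10.trans h.2.le⟩

theorem dist_le_of_mem_gridCube {n : ℕ} {δ : ℝ} (hδ : 0 ≤ δ) {k : Fin n → ℤ}
    {x y : EuclideanSpace ℝ (Fin n)} (hx : x ∈ gridCube n δ k) (hy : y ∈ gridCube n δ k) :
    dist x y ≤ √n * δ := by
  rw [EuclideanSpace.dist_eq]
  refine Real.sqrt_le_iff.mpr ⟨by positivity, ?_⟩
  rw [mul_pow, Real.sq_sqrt (Nat.cast_nonneg n)]
  refine (Finset.sum_le_card_nsmul _ _ (δ ^ 2) fun i _ => ?_).trans (by simp)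
  rw [Real.dist_eq, sq_abs]
  obtain ⟨h1, h2⟩ := hx i
  obtain ⟨h3, h4⟩ := hy i
  exact sq_le_sq' (by linarith) (by linarith)

theorem mem_gridCube_floor {n : ℕ} {δ : ℝ} (hδ : 0 < δ) (x : EuclideanSpace ℝ (Fin n)) :
    x ∈ gridCube n δ fun i => ⌊x i / δ⌋ := fun _ =>
  ⟨(le_div_iff₀ hδ).mp (Int.floor_le _), ((div_lt_iff₀ hδ).mp (Int.lt_floor_add_one _)).le⟩

/-- Half-open grid cubes are disjoint, so a set containing the cubes indexed by `S` has volume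
at least `#S • δ ^ n`. -/
theorem card_mul_le_volume {n : ℕ} {δ : ℝ} (hδ : 0 < δ) (S : Finset (Fin n → ℤ))
    {U : Set (EuclideanSpace ℝ (Fin n))} (hU : ∀ k ∈ S, gridCube n δ k ⊆ U) :
    ENNReal.ofReal (S.card * δ ^ n) ≤ volume U := by
  let b : (Fin n → ℤ) → Set (EuclideanSpace ℝ (Fin n)) := fun k =>
    WithLp.ofLp ⁻¹' Set.univ.pi fun i => Set.Ico ((k i : ℝ) * δ) (((k i : ℝ) + 1) * δ)
  have hpi : ∀ k : Fin n → ℤ, MeasurableSet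
      (Set.univ.pi fun i => Set.Ico ((k i : ℝ) * δ) (((k i : ℝ) + 1) * δ)) := fun k =>
    MeasurableSet.univ_pi fun i => measurableSet_Ico
  have hmp := PiLp.volume_preserving_ofLp (Fin n)
  have hb : ∀ k, MeasurableSet (b k) := fun k => hmp.measurable (hpi k)
  have hvol : ∀ k, volume (b k) = ENNReal.ofReal (δ ^ n) := by
    intro k
    rw [hmp.measure_preimage (hpi k).nullMeasurableSet, Real.volume_pi_Ico]
    simp [add_mul, ENNReal.ofReal_pow hδ.le]
  have hfl : ∀ k, ∀ x ∈ b k, ∀ i, k i = ⌊x i / δ⌋ := by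
    intro k x hx i
    obtain ⟨h1, h2⟩ := hx i trivial
    exact (Int.floor_eq_iff.mpr ⟨(le_div_iff₀ hδ).mpr h1, (div_lt_iff₀ hδ).mpr h2⟩).symm
  have hdis : Set.PairwiseDisjoint (S : Set (Fin n → ℤ)) b := by
    intro k _ l _ hkl
    refine Set.disjoint_left.mpr fun x hx hx' => hkl (funext fun i => ?_)
    rw [hfl k x hx i, hfl l x hx' i]
  calc ENNReal.ofReal (S.card * δ ^ n) = ∑ k ∈ S, volume (b k) := by
        simp [hvol, ENNReal.ofReal_mul]
    _ = volume (⋃ k ∈ S, b k) := (measure_biUnion_finset hdis fun k _ => hb k).symm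
    _ ≤ volume U := measure_mono <| Set.iUnion₂_subset fun k hk x hx =>
        hU k hk fun i => ⟨(hx i trivial).1, (hx i trivial).2.le⟩

theorem finite_setOf_gridCube_subset_unitCube (n : ℕ) {δ : ℝ} (hδ : 0 < δ) :
    {k : Fin n → ℤ | gridCube n δ k ⊆ unitCube n}.Finite := by
  refine (Set.finite_Icc (0 : Fin n → ℤ) fun _ => ⌊1 / δ⌋).subset fun k hk => ?_
  have hk' : WithLp.toLp 2 (fun i => (k i : ℝ) * δ) ∈ unitCube n := hk fun i =>
    ⟨le_rfl, by simp only [add_mul]; linarith⟩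
  refine ⟨fun i => ?_, fun i => ?_⟩
  · exact_mod_cast nonneg_of_mul_nonneg_left (hk' i).1 hδ
  · exact Int.le_floor.mpr ((le_div_iff₀ hδ).mpr (hk' i).2)

theorem gridCube_subset_unitCube {n : ℕ} {δ : ℝ} (hδ : δ ≤ 1 / 4) {k : Fin n → ℤ}
    {x : EuclideanSpace ℝ (Fin n)} (hx : x ∈ gridCube n δ k)
    (hx' : ∀ i, x i ∈ Set.Icc (1 / 4 : ℝ) (3 / 4)) : gridCube n δ k ⊆ unitCube n := by
  intro y hy i
  obtain ⟨h1, h2⟩ := hx i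
  obtain ⟨h3, h4⟩ := hy i
  obtain ⟨h5, h6⟩ := hx' i
  constructor <;> linarith

theorem exists_le_sqrt_mul_abs_apply {n : ℕ} {v : EuclideanSpace ℝ (Fin n)} (hv : ‖v‖ = 1) :
    ∃ i, 1 ≤ √n * |v i| := by
  by_contra! h
  have hsum : ∑ i, v i ^ 2 = 1 := by
    have := EuclideanSpace.real_norm_sq_eq v
    rw [← this, hv, one_pow]
  have hn : n ≠ 0 := by
    rintro rfl
    simp at hsum
  have : ∑ i, n * v i ^ 2 < ∑ _i : Fin n, (1 : ℝ) := by
    have : Nonempty (Fin n) := Fin.pos_iff_nonempty.mp (Nat.pos_of_ne_zero hn)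
    refine Finset.sum_lt_sum_of_nonempty Finset.univ_nonempty fun i _ => ?_
    have := pow_lt_one₀ (by positivity) (h i) two_ne_zero
    rwa [mul_pow, Real.sq_sqrt (Nat.cast_nonneg n), sq_abs] at this
  rw [← Finset.mul_sum, hsum] at this
  simp at this

/-- A segment of length `r` meets at least `r / (√n δ)` grid cubes. -/
theorem div_le_ncard_gridCube {n : ℕ} {δ r : ℝ} (hδ : 0 < δ) (hr : 0 ≤ r)
    {p v : EuclideanSpace ℝ (Fin n)} (hv : ‖v‖ = 1) {F : Set (Fin n → ℤ)} (hF : F.Finite)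
    (hpF : ∀ t ∈ Set.Icc 0 r, ∀ k, p + t • v ∈ gridCube n δ k → k ∈ F) :
    r / (√n * δ) ≤ F.ncard := by
  obtain ⟨i, hi⟩ := exists_le_sqrt_mul_abs_apply hv
  have hn : 0 < √(n : ℝ) := Real.sqrt_pos.mpr (Nat.cast_pos.mpr (i.pos))
  let x : ℕ → EuclideanSpace ℝ (Fin n) := fun j => p + (j * (√n * δ)) • v
  let f : ℕ → Fin n → ℤ := fun j l => ⌊x j l / δ⌋
  have hmaps : Set.MapsTo f (Finset.range (⌊r / (√n * δ)⌋₊ + 1)) F := by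
    intro j hj
    rw [Finset.mem_coe, Finset.mem_range, Nat.lt_succ_iff, Nat.le_floor_iff (by positivity),
      le_div_iff₀ (by positivity)] at hj
    exact hpF _ ⟨by positivity, hj⟩ _ (mem_gridCube_floor hδ (x j))
  have hinj : Function.Injective f := by
    intro j l hjl
    have h1 : |x j i / δ - x l i / δ| < 1 := Int.abs_sub_lt_one_of_floor_eq_floor (congrFun hjl i)
    have h2 : x j i / δ - x l i / δ = ((j : ℤ) - (l : ℤ) : ℤ) * (√n * v i) := by
      simp [x]
      field_simp
      ring
    by_contra hne
    have h3 : (1 : ℝ) ≤ |(((j : ℤ) - (l : ℤ) : ℤ) : ℝ)| := by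
      rw [← Int.cast_abs, ← Int.cast_one]
      exact Int.cast_le.mpr (Int.one_le_abs (by lia))
    rw [h2, abs_mul, abs_mul, abs_of_pos hn] at h1
    nlinarith
  have hle := Set.ncard_le_ncard hmaps.image_subset hF
  rw [Set.ncard_image_of_injective _ hinj, Set.ncard_coe_finset, Finset.card_range] at hle
  calc r / (√n * δ) ≤ (⌊r / (√n * δ)⌋₊ + 1 : ℕ) := by exact_mod_cast (Nat.lt_floor_add_one _).le
    _ ≤ F.ncard := by exact_mod_cast hle

/-- If some direction is not singular for each polynomial of degree at most `N`, then a set that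
lies well inside the unit cube and contains a segment of length `r` in every direction meets
many grid cubes. -/
theorem exists_card_gridCube_inter_nonempty_ge {n N : ℕ} {ε r : ℝ} (hn : n ≠ 0) (hN : N ≠ 0)
    (hr : 0 < r)
    (hconj : ∀ Q : MvPolynomial (Fin n) ℝ, Q ≠ 0 → Q.totalDegree ≤ N →
      ∃ v : EuclideanSpace ℝ (Fin n), ‖v‖ = 1 ∧ ¬ IsSingularDir N ε (√n / r) Q v)
    (hδ : (N : ℝ) ^ (-(1 + ε)) ≤ 1 / 4) {L : Set (EuclideanSpace ℝ (Fin n))}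
    (hL : ∀ x ∈ L, ∀ i, x i ∈ Set.Icc (1 / 4 : ℝ) (3 / 4))
    (hseg : ∀ v : EuclideanSpace ℝ (Fin n), ‖v‖ = 1 →
      ∃ p : EuclideanSpace ℝ (Fin n), ∀ t ∈ Set.Icc (0 : ℝ) r, p + t • v ∈ L) :
    ∃ S : Finset (Fin n → ℤ),
      (∀ k ∈ S, (gridCube n ((N : ℝ) ^ (-(1 + ε))) k ∩ L).Nonempty) ∧
        (N / n : ℝ) ^ n ≤ S.card := by
  set δ := (N : ℝ) ^ (-(1 + ε)) with hδdef
  have hNpos : (0 : ℝ) < N := Nat.cast_pos.mpr (Nat.pos_of_ne_zero hN)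
  have hδpos : 0 < δ := Real.rpow_pos_of_pos hNpos _
  have hsub : ∀ k, (gridCube n δ k ∩ L).Nonempty → gridCube n δ k ⊆ unitCube n :=
    fun k ⟨x, hx, hxL⟩ => gridCube_subset_unitCube hδ hx (hL x hxL)
  have hfin : {k | (gridCube n δ k ∩ L).Nonempty}.Finite :=
    (finite_setOf_gridCube_subset_unitCube n hδpos).subset hsub
  refine ⟨hfin.toFinset, fun k hk => (hfin.mem_toFinset).mp hk, ?_⟩
  have hcard : (N / n + 1) ^ n ≤ hfin.toFinset.card := by
    by_contra! h
    obtain ⟨Q, hQ, hdeg, hbis⟩ := exists_roughlyBisected_gridCube δ h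
    obtain ⟨v, hv, hsing⟩ := hconj Q hQ (hdeg.trans (Nat.mul_div_le N n))
    obtain ⟨p, hp⟩ := hseg v hv
    refine hsing ⟨p, ?_⟩
    refine Eq.trans_le ?_ (div_le_ncard_gridCube hδpos hr.le (p := p) hv
      ((finite_setOf_gridCube_subset_unitCube n hδpos).subset fun k hk => hk.1)
      fun t ht k hk => ?_)
    · rw [hδdef, Real.rpow_neg hNpos.le, inv_div]
      field_simp
    · have hk' : (gridCube n δ k ∩ L).Nonempty := ⟨_, hk, hp t ht⟩
      exact ⟨hsub k hk', hbis k (hfin.mem_toFinset.mpr hk'), _, hk, t, rfl⟩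
  have hle : (N / n : ℝ) ≤ (N / n + 1 : ℕ) := by
    rw [div_le_iff₀ (Nat.cast_pos.mpr (Nat.pos_of_ne_zero hn))]
    exact_mod_cast (Nat.lt_div_mul_add (Nat.pos_of_ne_zero hn) (a := N)).le.trans
      (by rw [add_mul, one_mul])
  calc (N / n : ℝ) ^ n ≤ ((N / n + 1 : ℕ) : ℝ) ^ n := by gcongr
    _ ≤ hfin.toFinset.card := by exact_mod_cast hcard

theorem IsCompact.exists_pos_mul_abs_le {n : ℕ} {K : Set (EuclideanSpace ℝ (Fin n))}
    (hK : IsCompact K) :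
    ∃ r : ℝ, 0 < r ∧ r ≤ 1 ∧ ∀ x ∈ K, ∀ i, |r * x i| ≤ 1 / 4 := by
  obtain ⟨R, hR⟩ := hK.isBounded.exists_norm_le
  refine ⟨(4 * (|R| + 1))⁻¹, by positivity, ?_, fun x hx i => ?_⟩
  · exact inv_le_one_of_one_le₀ (by linarith [abs_nonneg R])
  · have h1 : |x i| ≤ |R| + 1 := by
      have := PiLp.norm_apply_le x i
      rw [Real.norm_eq_abs] at this
      linarith [hR x hx, le_abs_self R]
    rw [abs_mul, abs_of_pos (by positivity), inv_mul_le_iff₀ (by positivity)]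
    linarith

/-- Contracting by a factor `r ≤ 1` does not increase the volume. -/
theorem volume_preimage_smul_sub_le {n : ℕ} {r : ℝ} (hr : 0 < r) (hr1 : r ≤ 1)
    (z : EuclideanSpace ℝ (Fin n)) (W : Set (EuclideanSpace ℝ (Fin n))) :
    volume ((fun y => r⁻¹ • (y - z)) ⁻¹' W) ≤ volume W := by
  have h : volume ((fun y => r⁻¹ • (y - z)) ⁻¹' W) = volume ((r⁻¹ • ·) ⁻¹' W) :=
    (measurePreserving_sub_right volume z).measure_preimage_equiv
      (f := MeasurableEquiv.subRight z) ((r⁻¹ • ·) ⁻¹' W)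
  rw [h, Measure.addHaar_preimage_smul _ (inv_ne_zero hr.ne')]
  refine mul_le_of_le_one_left' ?_
  rw [ENNReal.ofReal_le_one, inv_pow, inv_inv, abs_of_pos (by positivity)]
  exact pow_le_one₀ hr.le hr1

theorem volume_infDist_le_ge {n N : ℕ} {ε r : ℝ} (hn : n ≠ 0) (hN : N ≠ 0)
    (hr : 0 < r) (hr1 : r ≤ 1)
    (hconj : ∀ Q : MvPolynomial (Fin n) ℝ, Q ≠ 0 → Q.totalDegree ≤ N →
      ∃ v : EuclideanSpace ℝ (Fin n), ‖v‖ = 1 ∧ ¬ IsSingularDir N ε (√n / r) Q v)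
    (hδ : (N : ℝ) ^ (-(1 + ε)) ≤ 1 / 4) {K : Set (EuclideanSpace ℝ (Fin n))}
    (hrK : ∀ x ∈ K, ∀ i, |r * x i| ≤ 1 / 4)
    (hseg : ∀ v : EuclideanSpace ℝ (Fin n), ‖v‖ = 1 →
      ∃ x : EuclideanSpace ℝ (Fin n), ∀ t ∈ Set.Icc (0 : ℝ) 1, x + t • v ∈ K) :
    ENNReal.ofReal ((N / n : ℝ) ^ n * ((N : ℝ) ^ (-(1 + ε))) ^ n) ≤
      volume {x | Metric.infDist x K ≤ √n / r * (N : ℝ) ^ (-(1 + ε))} := by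
  let z : EuclideanSpace ℝ (Fin n) := WithLp.toLp 2 fun _ => 1 / 2
  have hNpos : (0 : ℝ) < N := Nat.cast_pos.mpr (Nat.pos_of_ne_zero hN)
  obtain ⟨S, hS, hcard⟩ := exists_card_gridCube_inter_nonempty_ge
    (L := (fun x => r • x + z) '' K) hn hN hr hconj hδ
    (by
      rintro _ ⟨x, hx, rfl⟩ i
      obtain ⟨h1, h2⟩ := abs_le.mp (hrK x hx i)
      simp only [PiLp.add_apply, PiLp.smul_apply, smul_eq_mul, z]
      constructor <;> linarith)
    (by
      intro v hv
      obtain ⟨x, hx⟩ := hseg v hv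
      refine ⟨r • x + z, fun t ht => ⟨x + (t / r) • v, hx _ ⟨?_, ?_⟩, ?_⟩⟩
      · exact div_nonneg ht.1 hr.le
      · exact (div_le_one hr).mpr ht.2
      · simp only [smul_add, smul_smul, mul_div_cancel₀ t hr.ne']
        abel)
  set δ := (N : ℝ) ^ (-(1 + ε))
  have hδpos : 0 < δ := Real.rpow_pos_of_pos hNpos _
  refine le_trans ?_ ((card_mul_le_volume hδpos S fun k hk y hy => ?_).trans
    (volume_preimage_smul_sub_le hr hr1 z _))
  · gcongr
  · obtain ⟨_, hw, x, hx, rfl⟩ := hS k hk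
    refine (Metric.infDist_le_dist_of_mem hx).trans ?_
    have hxy : x = r⁻¹ • (r • x + z - z) := by
      rw [add_sub_cancel_right, inv_smul_smul₀ hr.ne']
    have hd := dist_le_of_mem_gridCube hδpos.le hy hw
    calc dist (r⁻¹ • (y - z)) x = dist (r⁻¹ • (y - z)) (r⁻¹ • (r • x + z - z)) := by rw [← hxy]
      _ = r⁻¹ * dist y (r • x + z) := by
        rw [dist_smul₀, dist_sub_right, norm_inv, Real.norm_of_nonneg hr.le]
      _ ≤ r⁻¹ * (√n * δ) := by gcongr
      _ = √n / r * δ := by ring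

/-- Conjecture on singular directions implies the Minkowski version of the Kakeya
conjecture: if for all `ε, H > 0` and all sufficiently large `N`, no nonzero polynomial
of degree at most `N` has every direction `(N, ε, H)`-singular, then every Kakeya set
in `ℝ^n` has lower Minkowski dimension `n`. -/
theorem singular_direction_conj_implies_kakeya_minkowski
    (n : ℕ) (hn : 2 ≤ n)
    (hconj : ∀ ε : ℝ, 0 < ε → ∀ H : ℝ, 0 < H → ∃ N₀ : ℕ, ∀ N : ℕ, N₀ ≤ N →
      ∀ Q : MvPolynomial (Fin n) ℝ, Q ≠ 0 → Q.totalDegree ≤ N →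
        ∃ v : EuclideanSpace ℝ (Fin n), ‖v‖ = 1 ∧ ¬ IsSingularDir N ε H Q v) :
    ∀ K : Set (EuclideanSpace ℝ (Fin n)), IsKakeyaSet K →
      ∀ κ : ℝ, 0 < κ → ∃ c : ℝ, 0 < c ∧
        ∀ δ : ℝ, 0 < δ → δ < 1 →
          ENNReal.ofReal (c * δ ^ κ) ≤
            volume {x : EuclideanSpace ℝ (Fin n) | Metric.infDist x K ≤ δ} := by
  rintro K ⟨hK, hseg⟩ κ hκ
  have hn0 : n ≠ 0 := by lia
  have hnpos : (0 : ℝ) < n := Nat.cast_pos.mpr (Nat.pos_of_ne_zero hn0)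
  obtain ⟨r, hr, hr1, hrK⟩ := hK.exists_pos_mul_abs_le
  set C : ℝ := √n / r with hC
  have hC1 : 1 ≤ C := (one_le_div hr).mpr
    (hr1.trans (Real.one_le_sqrt.mpr (by exact_mod_cast Nat.one_le_iff_ne_zero.mpr hn0)))
  have hC0 : 0 < C := one_pos.trans_le hC1
  obtain ⟨N₀, hN₀⟩ := hconj (κ / n) (by positivity) C hC0
  set M : ℕ := max N₀ 4
  have hM : 4 ≤ M := le_max_right _ _
  have hM4 : (4 : ℝ) ≤ M := by exact_mod_cast hM
  refine ⟨((n : ℝ) ^ n)⁻¹ * (2 * M * C) ^ (-κ), by positivity, fun δ hδ hδ1 => ?_⟩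
  have hx : 1 < C / δ := (one_lt_div hδ).mpr (hδ1.trans_le hC1)
  set N : ℕ := M * ⌈C / δ⌉₊
  have hceil : 1 ≤ ⌈C / δ⌉₊ := Nat.one_le_ceil_iff.mpr (one_pos.trans hx)
  have hMN : M ≤ N := Nat.le_mul_of_pos_right M hceil
  have hN4 : (4 : ℝ) ≤ N := hM4.trans (by exact_mod_cast hMN)
  have hN0 : (0 : ℝ) < N := by linarith
  have hxN : C / δ ≤ N := by
    refine (Nat.le_ceil _).trans ?_
    exact_mod_cast Nat.le_mul_of_pos_left _ (by lia : 0 < M)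
  have hNx : (N : ℝ) ≤ 2 * M * C * δ⁻¹ := by
    have h := (Nat.ceil_lt_add_one (one_pos.trans hx).le).le
    calc (N : ℝ) = M * (⌈C / δ⌉₊ : ℝ) := by push_cast [N]; rfl
      _ ≤ M * (2 * (C / δ)) := by gcongr; linarith
      _ = 2 * M * C * δ⁻¹ := by ring
  have hpow : (N : ℝ) ^ (-(1 + κ / n)) ≤ (N : ℝ)⁻¹ := by
    rw [← Real.rpow_neg_one]
    exact Real.rpow_le_rpow_of_exponent_le (by linarith)
      (by have : 0 < κ / n := by positivity
          linarith)
  have hquarter : (N : ℝ) ^ (-(1 + κ / n)) ≤ 1 / 4 :=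
    hpow.trans (by rw [one_div]; exact inv_anti₀ (by norm_num) hN4)
  have hmain := volume_infDist_le_ge hn0 (by lia) hr hr1
    (hN₀ N ((le_max_left _ _).trans hMN)) hquarter hrK hseg
  refine le_trans (ENNReal.ofReal_le_ofReal ?_) (hmain.trans (measure_mono fun x hx' => ?_))
  · calc ((n : ℝ) ^ n)⁻¹ * (2 * M * C) ^ (-κ) * δ ^ κ
        = ((n : ℝ) ^ n)⁻¹ * (2 * M * C * δ⁻¹) ^ (-κ) := by
          rw [Real.mul_rpow (x := 2 * M * C) (by positivity) (by positivity), Real.inv_rpow hδ.le,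
            Real.rpow_neg hδ.le, inv_inv, mul_assoc]
      _ ≤ ((n : ℝ) ^ n)⁻¹ * (N : ℝ) ^ (-κ) := by
          gcongr ?_ * ?_
          exact Real.rpow_le_rpow_of_nonpos hN0 hNx (by linarith)
      _ = (N / n : ℝ) ^ n * ((N : ℝ) ^ (-(1 + κ / n))) ^ n := by
          rw [← mul_pow, div_mul_eq_mul_div, div_pow, ← Real.rpow_one_add' hN0.le,
            ← Real.rpow_natCast (N ^ _), ← Real.rpow_mul hN0.le, div_eq_inv_mul]
          · congr 2
            field_simp
            ring
          · have : 0 < κ / n := by positivity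
            linarith
  · refine le_trans (Set.mem_ofPred_eq ▸ hx') ?_
    calc C * (N : ℝ) ^ (-(1 + κ / n)) ≤ C * (C / δ)⁻¹ := by
          gcongr
          exact hpow.trans (inv_anti₀ (by positivity) hxN)
      _ = δ := by field_simp
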